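/- Let D be a dissipation distance density and define R(F,Ḟ) := (1/4)∂²_{F₁²}D²(F,F)[Ḟ,Ḟ]. Then there exists an open neighborhood U of SO(3) contained in GL₊(3) such that R depends only on the right Cauchy–Green tensor C = FᵀF and its rate Ċ = ḞᵀF + FᵀḞ, and is quadratic in Ċ. Precisely: (a) if F₁,F₂ ∈ U and Ḟ₁,Ḟ₂ ∈ ℝ^{3×3} satisfy F₁ᵀF₁ = F₂ᵀF₂ and Ḟ₁ᵀF₁ + F₁ᵀḞ₁ = Ḟ₂ᵀF₂ + F₂ᵀḞ₂, then R(F₁,Ḟ₁) = R(F₂,Ḟ₂); (b) for each F ∈ U there is a quadratic form q_F on the symmetric 3×3 matrices with R(F,Ḟ) = q_F(ḞᵀF + FᵀḞ) for all Ḟ ∈ ℝ^{3×3}. -/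

import Mathlib

open Matrix Filter Topology

noncomputable section

attribute [local instance] Matrix.normedAddCommGroup Matrix.normedSpace

/-- Real `3 × 3` matrices. -/
abbrev Mat3 := Matrix (Fin 3) (Fin 3) ℝ

/-- Squared Frobenius norm. -/
def frobSq (A : Mat3) : ℝ := ∑ i, ∑ j, (A i j) ^ 2

/-- Frobenius norm. -/
def frobNorm (A : Mat3) : ℝ := Real.sqrt (frobSq A)

/-- Symmetric part of a matrix. -/
def symPart (A : Mat3) : Mat3 := (2 : ℝ)⁻¹ • (A + Aᵀ)

/-- Matrices with positive determinant. -/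
def GLp : Set Mat3 := {F | 0 < F.det}

/-- The special orthogonal group `SO(3)`. -/
def SO3 : Set Mat3 := {Q | Qᵀ * Q = 1 ∧ Q.det = 1}

/-- The second Fréchet derivative of `F ↦ D(F, F₂)²` at `F₁`, applied to `(G, H)`. -/
def D2bil (D : Mat3 → Mat3 → ℝ) (F₁ F₂ G H : Mat3) : ℝ :=
  iteratedFDeriv ℝ 2 (fun F => (D F F₂) ^ 2) F₁ ![G, H]

/-- A dissipation distance density `D : GL₊(3) × GL₊(3) → [0,∞)`, satisfying
conditions (i)–(vi). -/
structure IsDissipationDensity (D : Mat3 → Mat3 → ℝ) : Prop where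
  nonneg : ∀ F₁ ∈ GLp, ∀ F₂ ∈ GLp, 0 ≤ D F₁ F₂
  eq_zero : ∀ F₁ ∈ GLp, ∀ F₂ ∈ GLp, F₁ᵀ * F₁ = F₂ᵀ * F₂ → D F₁ F₂ = 0
  pos_of_ne : ∀ F₁ ∈ GLp, ∀ F₂ ∈ GLp, F₁ᵀ * F₁ ≠ F₂ᵀ * F₂ → 0 < D F₁ F₂
  symm : ∀ F₁ ∈ GLp, ∀ F₂ ∈ GLp, D F₁ F₂ = D F₂ F₁
  triangle : ∀ F₁ ∈ GLp, ∀ F₂ ∈ GLp, ∀ F₃ ∈ GLp, D F₁ F₃ ≤ D F₁ F₂ + D F₂ F₃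
  smooth : ∃ V : Set (Mat3 × Mat3), IsOpen V ∧ SO3 ×ˢ SO3 ⊆ V ∧ V ⊆ GLp ×ˢ GLp ∧
    ContDiffOn ℝ 3 (fun p : Mat3 × Mat3 => (D p.1 p.2) ^ 2) V
  frame_indiff : ∀ Q₁ ∈ SO3, ∀ Q₂ ∈ SO3, ∀ F₁ ∈ GLp, ∀ F₂ ∈ GLp,
    D (Q₁ * F₁) (Q₂ * F₂) = D F₁ F₂
  coercive : ∃ c > (0 : ℝ), ∀ G : Mat3, c * frobSq (symPart G) ≤ D2bil D 1 1 G G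

/-- The viscous dissipation potential `R(F,Ḟ) := (1/4)·∂²_{F₁²}D²(F,F)[Ḟ,Ḟ]`. -/
def Rpot (D : Mat3 → Mat3 → ℝ) (F Fdot : Mat3) : ℝ := (1 / 4 : ℝ) * D2bil D F F Fdot Fdot

/-- The submodule of symmetric `3 × 3` matrices. -/
def symSub : Submodule ℝ Mat3 where
  carrier := {A | Aᵀ = A}
  add_mem' := by
    intro a b ha hb
    simp only [Set.mem_setOf_eq] at *
    rw [Matrix.transpose_add, ha, hb]
  zero_mem' := by simp only [Set.mem_setOf_eq, Matrix.transpose_zero]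
  smul_mem' := by
    intro c a ha
    simp only [Set.mem_setOf_eq] at *
    rw [Matrix.transpose_smul, ha]

lemma exp_mem_SO3 (A : Mat3) (hA : Aᵀ = -A) (t : ℝ) : NormedSpace.exp (t • A) ∈ SO3 := by
  have h1 : ∀ s : ℝ, (NormedSpace.exp (s • A))ᵀ * NormedSpace.exp (s • A) = 1 := by
    intro s
    rw [← Matrix.exp_transpose, Matrix.transpose_smul, hA, smul_neg, Matrix.exp_neg]
    exact Matrix.nonsing_inv_mul _ ((Matrix.isUnit_iff_isUnit_det _).1 (Matrix.isUnit_exp _))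
  refine ⟨h1 t, ?_⟩
  have h2 : t • A = (t / 2) • A + (t / 2) • A := by
    rw [← add_smul]; congr 1; ring
  have h3 := congrArg Matrix.det (h1 (t / 2))
  rw [Matrix.det_mul, Matrix.det_transpose, Matrix.det_one] at h3
  rw [h2, Matrix.exp_add_of_commute _ _ (Commute.refl _), Matrix.det_mul]
  exact h3

lemma hasDerivAt_matexp (A : Mat3) :
    HasDerivAt (fun t : ℝ => NormedSpace.exp (t • A)) A 0 := by
  have h := @hasDerivAt_exp_smul_const ℝ Mat3 _ Matrix.linftyOpNormedRing
    Matrix.linftyOpNormedAlgebra _ A 0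
  rw [zero_smul, NormedSpace.exp_zero, one_mul] at h
  exact h

/-- Left multiplication. -/
def lmul (A : Mat3) : Mat3 →L[ℝ] Mat3 := LinearMap.toContinuousLinearMap (LinearMap.mulLeft ℝ A)

lemma lmul_apply (A X : Mat3) : lmul A X = A * X := rfl

/-- Right multiplication. -/
def rmul (A : Mat3) : Mat3 →L[ℝ] Mat3 := LinearMap.toContinuousLinearMap (LinearMap.mulRight ℝ A)

lemma rmul_apply (A X : Mat3) : rmul A X = X * A := rfl

lemma one_mem_SO3 : (1 : Mat3) ∈ SO3 := by simp [SO3]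

lemma isOpen_GLp : IsOpen GLp := isOpen_lt continuous_const (by fun_prop)

lemma fderiv_skew {D : Mat3 → Mat3 → ℝ} (hD : IsDissipationDensity D) {F X A : Mat3}
    (hF : F ∈ GLp) (hX : X ∈ GLp) (hA : Aᵀ = -A)
    (hd : DifferentiableAt ℝ (fun Y => (D Y F) ^ 2) X) :
    fderiv ℝ (fun Y => (D Y F) ^ 2) X (A * X) = 0 := by
  have h1 : HasDerivAt (fun t : ℝ => rmul X (NormedSpace.exp (t • A))) (rmul X A) 0 :=
    (rmul X).hasFDerivAt.comp_hasDerivAt (0 : ℝ) (hasDerivAt_matexp A)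
  have h0 : rmul X (NormedSpace.exp ((0 : ℝ) • A)) = X := by
    simp [rmul_apply]
  have h2 := HasFDerivAt.comp_hasDerivAt_of_eq (0 : ℝ) hd.hasFDerivAt h1 h0.symm
  have h3 : ((fun Y => (D Y F) ^ 2) ∘ fun t : ℝ => rmul X (NormedSpace.exp (t • A)))
      = fun _ => (D X F) ^ 2 := by
    funext t
    have := hD.frame_indiff _ (exp_mem_SO3 A hA t) 1 one_mem_SO3 X hX F hF
    rw [one_mul] at this
    simp only [Function.comp, rmul_apply, this]
  rw [h3] at h2
  exact h2.unique (hasDerivAt_const _ _)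

lemma fderiv2_skew {D : Mat3 → Mat3 → ℝ} (hD : IsDissipationDensity D) {F A : Mat3}
    (hF : F ∈ GLp) (hA : Aᵀ = -A)
    (hd : ContDiffAt ℝ 3 (fun Y => (D Y F) ^ 2) F) (H : Mat3) :
    fderiv ℝ (fderiv ℝ (fun Y => (D Y F) ^ 2)) F H (A * F) = 0 := by
  have hmin : fderiv ℝ (fun Y => (D Y F) ^ 2) F = 0 := by
    apply IsLocalMin.fderiv_eq_zero
    refine Filter.Eventually.of_forall fun Y => ?_
    simp only [hD.eq_zero F hF F hF rfl]
    rw [zero_pow two_ne_zero]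
    exact sq_nonneg _
  have hev : ∀ᶠ X in 𝓝 F, fderiv ℝ (fun Y => (D Y F) ^ 2) X (lmul A X) = 0 := by
    filter_upwards [isOpen_GLp.mem_nhds hF, hd.eventually (by simp)] with X hX hdX
    exact fderiv_skew hD hF hX hA (hdX.differentiableAt (by simp))
  have hdd : DifferentiableAt ℝ (fderiv ℝ (fun Y => (D Y F) ^ 2)) F :=
    (hd.fderiv_right (m := 2) (by norm_num)).differentiableAt (by simp)
  have h1 := hdd.hasFDerivAt.clm_apply (lmul A).hasFDerivAt
  have h2 : HasFDerivAt (fun X => fderiv ℝ (fun Y => (D Y F) ^ 2) X (lmul A X))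
      (0 : Mat3 →L[ℝ] ℝ) F :=
    (hasFDerivAt_const (0 : ℝ) F).congr_of_eventuallyEq hev
  have h3 := congrArg (fun L : Mat3 →L[ℝ] ℝ => L H) (h1.unique h2)
  have h4 : fderiv ℝ (fun Y => (D Y F) ^ 2) F (lmul A H)
      + fderiv ℝ (fderiv ℝ (fun Y => (D Y F) ^ 2)) F H (A * F) = 0 := h3
  rw [hmin] at h4
  have h5 : (0 : ℝ) + fderiv ℝ (fderiv ℝ (fun Y => (D Y F) ^ 2)) F H (A * F) = 0 := h4
  rwa [zero_add] at h5

lemma D2bil_eq (D : Mat3 → Mat3 → ℝ) (F E G H : Mat3) :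
    D2bil D F E G H = fderiv ℝ (fderiv ℝ (fun Y => (D Y E) ^ 2)) F G H := by
  unfold D2bil
  rw [iteratedFDeriv_two_apply]
  rfl

lemma D2bil_skew {D : Mat3 → Mat3 → ℝ} (hD : IsDissipationDensity D) {F : Mat3}
    (hF : F ∈ GLp) (hd : ContDiffAt ℝ 3 (fun Y => (D Y F) ^ 2) F) {G W : Mat3}
    (hGW : Gᵀ * F + Fᵀ * G = Wᵀ * F + Fᵀ * W) :
    D2bil D F F G G = D2bil D F F W W := by
  have hu : IsUnit F.det := (ne_of_gt hF).isUnit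
  set A : Mat3 := (G - W) * F⁻¹ with hAdef
  have hAF : G = W + A * F := by
    rw [hAdef, Matrix.nonsing_inv_mul_cancel_right _ _ hu]; abel
  clear_value A
  have hA : Aᵀ = -A := by
    have h1 : Fᵀ * (Aᵀ + A) * F = 0 := by
      have : Fᵀ * (Aᵀ + A) * F = (A * F)ᵀ * F + Fᵀ * (A * F) := by
        rw [Matrix.transpose_mul]; noncomm_ring
      rw [this]
      have h2 : A * F = G - W := by rw [hAF]; abel
      rw [h2, Matrix.transpose_sub, sub_mul, mul_sub]
      rw [← sub_eq_zero] at hGW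
      rw [← hGW]; abel
    have hut : IsUnit (Fᵀ).det := by rwa [Matrix.det_transpose]
    have h2 : (Fᵀ)⁻¹ * (Fᵀ * (Aᵀ + A) * F) * F⁻¹ = Aᵀ + A := by
      rw [mul_assoc Fᵀ, Matrix.nonsing_inv_mul_cancel_left _ _ hut,
        Matrix.mul_nonsing_inv_cancel_right _ _ hu]
    rw [h1] at h2
    simp only [mul_zero, zero_mul] at h2
    exact eq_neg_of_add_eq_zero_left h2.symm
  have hs : fderiv ℝ (fderiv ℝ (fun Y => (D Y F) ^ 2)) F (A * F) W
      = fderiv ℝ (fderiv ℝ (fun Y => (D Y F) ^ 2)) F W (A * F) :=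
    (hd.isSymmSndFDerivAt (by simp; norm_num)).eq _ _
  have hk := fderiv2_skew hD hF hA hd
  rw [D2bil_eq, D2bil_eq, hAF]
  simp only [map_add, _root_.add_apply, hs, hk, add_zero]

lemma comp_aux {E : Type*} [NormedAddCommGroup E] [NormedSpace ℝ E] (L : E →L[ℝ] E)
    (f g : E → (E →L[ℝ] ℝ)) (x : E) (h : DifferentiableAt ℝ f (L x))
    (hg : ∀ᶠ y in 𝓝 x, g y = (f (L y)).comp L) (G H : E) :
    fderiv ℝ g x G H = fderiv ℝ f (L x) (L G) (L H) := by
  have hc : HasFDerivAt (fun y => f (L y)) ((fderiv ℝ f (L x)).comp L) x :=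
    h.hasFDerivAt.comp x L.hasFDerivAt
  have h4 := hc.clm_comp (hasFDerivAt_const L x)
  rw [(h4.congr_of_eventuallyEq hg).fderiv]
  simp

lemma D2bil_rot {D : Mat3 → Mat3 → ℝ} (hD : IsDissipationDensity D) {F Q : Mat3}
    (hF : F ∈ GLp) (hQ : Q ∈ SO3)
    (hd : ContDiffAt ℝ 3 (fun Y => (D Y (Q * F)) ^ 2) (Q * F)) (G H : Mat3) :
    D2bil D F F G H = D2bil D (Q * F) (Q * F) (Q * G) (Q * H) := by
  have h1 : ∀ X ∈ GLp, (D X F) ^ 2 = (D (lmul Q X) (Q * F)) ^ 2 := by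
    intro X hX
    rw [lmul_apply, hD.frame_indiff Q hQ Q hQ X hX F hF]
  have h2 : ∀ᶠ X in 𝓝 F, fderiv ℝ (fun Y => (D Y F) ^ 2) X
      = (fderiv ℝ (fun Y => (D Y (Q * F)) ^ 2) (lmul Q X)).comp (lmul Q) := by
    have hc : Tendsto (lmul Q) (𝓝 F) (𝓝 (Q * F)) := (lmul Q).continuous.tendsto F
    filter_upwards [isOpen_GLp.mem_nhds hF, hc.eventually (hd.eventually (by simp))] with X hX hdX
    have hdd : DifferentiableAt ℝ (fun Y => (D Y (Q * F)) ^ 2) (lmul Q X) :=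
      hdX.differentiableAt (by simp)
    have h3 := hdd.hasFDerivAt.comp X (lmul Q).hasFDerivAt
    refine (h3.congr_of_eventuallyEq ?_).fderiv
    filter_upwards [isOpen_GLp.mem_nhds hX] with Y hY
    exact h1 Y hY
  have hdd : DifferentiableAt ℝ (fderiv ℝ (fun Y => (D Y (Q * F)) ^ 2)) (lmul Q F) :=
    (hd.fderiv_right (m := 2) (by norm_num)).differentiableAt (by simp)
  rw [D2bil_eq, D2bil_eq]
  exact comp_aux (lmul Q) _ _ F hdd h2 G H

/-- `½ F⁻ᵀ C`. -/
def liftC (F : Mat3) : symSub →ₗ[ℝ] Mat3 :=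
  (LinearMap.mulLeft ℝ ((2 : ℝ)⁻¹ • (Fᵀ)⁻¹)).comp symSub.subtype

/-- The second derivative as a bilinear map. -/
def bilD (D : Mat3 → Mat3 → ℝ) (F : Mat3) : LinearMap.BilinMap ℝ Mat3 ℝ :=
  LinearMap.mk₂ ℝ (fun G H => (1 / 4 : ℝ) * fderiv ℝ (fderiv ℝ (fun Y => (D Y F) ^ 2)) F G H)
    (by intros; simp [mul_add]) (by intros; simp; ring)
    (by intros; simp [mul_add]) (by intros; simp; ring)

/-- On an open neighborhood `U` of `SO(3)` inside `GL₊(3)`, the potential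
`R` depends only on `C = FᵀF` and `Ċ = ḞᵀF + FᵀḞ`, and is quadratic in `Ċ`:
(a) equal `C` and `Ċ` give equal values of `R`; (b) for each `F ∈ U` there is a quadratic
form `q_F` on the symmetric matrices with `R(F,Ḟ) = q_F(ḞᵀF + FᵀḞ)`. -/
theorem statement2 (D : Mat3 → Mat3 → ℝ) (hD : IsDissipationDensity D) :
    ∃ U : Set Mat3, IsOpen U ∧ SO3 ⊆ U ∧ U ⊆ GLp ∧
      ((∀ F₁ ∈ U, ∀ F₂ ∈ U, ∀ Fdot₁ Fdot₂ : Mat3,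
          F₁ᵀ * F₁ = F₂ᵀ * F₂ →
          Fdot₁ᵀ * F₁ + F₁ᵀ * Fdot₁ = Fdot₂ᵀ * F₂ + F₂ᵀ * Fdot₂ →
          Rpot D F₁ Fdot₁ = Rpot D F₂ Fdot₂) ∧
       (∀ F ∈ U, ∃ q : QuadraticMap ℝ (↥symSub) ℝ, ∀ Fdot : Mat3,
          ∀ h : Fdotᵀ * F + Fᵀ * Fdot ∈ symSub,
            Rpot D F Fdot = q ⟨Fdotᵀ * F + Fᵀ * Fdot, h⟩)) := by
  obtain ⟨V, hVo, hSV, hVG, hsm⟩ := hD.smooth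
  have hdiff : ∀ F : Mat3, (F, F) ∈ V → ContDiffAt ℝ 3 (fun Y => (D Y F) ^ 2) F := by
    intro F hF
    have h1 : ContDiffAt ℝ 3 (fun p : Mat3 × Mat3 => (D p.1 p.2) ^ 2) (F, F) :=
      hsm.contDiffAt (hVo.mem_nhds hF)
    have h2 : ContDiffAt ℝ 3 (fun Y : Mat3 => (Y, F)) F := contDiffAt_id.prodMk contDiffAt_const
    exact ContDiffAt.comp (g := fun p : Mat3 × Mat3 => (D p.1 p.2) ^ 2)
      (f := fun Y : Mat3 => (Y, F)) F h1 h2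
  refine ⟨{F | (F, F) ∈ V}, hVo.preimage (continuous_id.prodMk continuous_id),
    fun F hF => hSV ⟨hF, hF⟩, fun F hF => (hVG hF).1, ?_, ?_⟩
  · intro F₁ hF₁ F₂ hF₂ G₁ G₂ hC hR
    have hG₁ : 0 < F₁.det := (hVG hF₁).1
    have hG₂ : 0 < F₂.det := (hVG hF₂).1
    have hu : IsUnit F₁.det := (ne_of_gt hG₁).isUnit
    have hut : IsUnit (F₁ᵀ).det := by rwa [Matrix.det_transpose]
    set Q : Mat3 := F₂ * F₁⁻¹ with hQdef
    have hQF : Q * F₁ = F₂ := Matrix.nonsing_inv_mul_cancel_right _ _ hu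
    have hQQ : Qᵀ * Q = 1 := by
      have : Qᵀ * Q = (F₁⁻¹)ᵀ * (F₂ᵀ * F₂) * F₁⁻¹ := by
        rw [hQdef, Matrix.transpose_mul]; noncomm_ring
      rw [this, ← hC, Matrix.transpose_nonsing_inv, Matrix.nonsing_inv_mul_cancel_left _ _ hut,
        Matrix.mul_nonsing_inv _ hu]
    have hQ : Q ∈ SO3 := by
      refine ⟨hQQ, ?_⟩
      have h1 := congrArg Matrix.det hQQ
      rw [Matrix.det_mul, Matrix.det_transpose, Matrix.det_one] at h1
      have h2 := congrArg Matrix.det hQF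
      rw [Matrix.det_mul] at h2
      have h3 : 0 < Q.det := by
        by_contra hn
        push Not at hn
        nlinarith [mul_nonneg (neg_nonneg.2 hn) hG₁.le]
      nlinarith
    have hd₂ := hdiff F₂ hF₂
    clear_value Q
    have e1 := D2bil_rot hD hG₁ hQ (by rw [hQF]; exact hd₂) G₁ G₁
    rw [hQF] at e1
    unfold Rpot
    rw [e1]
    congr 1
    apply D2bil_skew hD hG₂ hd₂
    rw [← hR, ← hQF, Matrix.transpose_mul Q G₁, Matrix.transpose_mul Q F₁]
    have a1 : G₁ᵀ * Qᵀ * (Q * F₁) = G₁ᵀ * (Qᵀ * Q) * F₁ := by noncomm_ring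
    have a2 : F₁ᵀ * Qᵀ * (Q * G₁) = F₁ᵀ * (Qᵀ * Q) * G₁ := by noncomm_ring
    rw [a1, a2, hQQ, mul_one, mul_one]
  · intro F hF
    have hG : 0 < F.det := (hVG hF).1
    have hu : IsUnit F.det := (ne_of_gt hG).isUnit
    have hut : IsUnit (Fᵀ).det := by rwa [Matrix.det_transpose]
    refine ⟨(LinearMap.BilinMap.toQuadraticMap (bilD D F)).comp (liftC F), fun G h => ?_⟩
    have e : D2bil D F F G G = D2bil D F F (liftC F ⟨_, h⟩) (liftC F ⟨_, h⟩) := by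
      apply D2bil_skew hD hG (hdiff F hF)
      have hs : (Gᵀ * F + Fᵀ * G)ᵀ = Gᵀ * F + Fᵀ * G := h
      have hl : liftC F ⟨_, h⟩ = (2 : ℝ)⁻¹ • ((Fᵀ)⁻¹ * (Gᵀ * F + Fᵀ * G)) := by
        simp [liftC]
      rw [hl]
      generalize Gᵀ * F + Fᵀ * G = C at hs
      rw [Matrix.transpose_smul, Matrix.transpose_mul, hs, Matrix.transpose_nonsing_inv,
        Matrix.transpose_transpose, Matrix.smul_mul, Matrix.mul_smul,
        Matrix.nonsing_inv_mul_cancel_right _ _ hu, Matrix.mul_nonsing_inv_cancel_left _ _ hut,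
        ← add_smul]
      norm_num
    unfold Rpot
    rw [e, D2bil_eq]
    rfl
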